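/- Let n ≥ 1, 1 ≤ k ≤ n, γ(t) = (1, t, …, tⁿ) ∈ ℝ^{n+1}, and let M : ℝⁿ → ℝⁿ be the linear projection (Mx)_i = x_i for i ≤ k and (Mx)_i = 0 for i > k. A continuous function ψ : [0,1]ⁿ → ℝ is invariant under all permutations of its first k coordinates if and only if there exists a continuous function ρ : ℝⁿ × ℝ^{n+1} → ℝ such that ψ(x) = ρ((I − M)x, ∑_{i=1}^{n} γ((Mx)_i)) for all x ∈ [0,1]ⁿ. -/

import Mathlib

open Finset in
/-- Over a field of characteristic zero, the power sums of degree at most `N` determine the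
elementary symmetric functions of degree at most `N`. -/
theorem MvPolynomial.aeval_esymm_eq_of_sum_pow_eq {σ K : Type*} [Fintype σ] [Field K] [CharZero K]
    {u v : σ → K} {N : ℕ} (h : ∀ j ≤ N, ∑ i, u i ^ j = ∑ i, v i ^ j) :
    ∀ m ≤ N, aeval u (esymm σ K m) = aeval v (esymm σ K m) := by
  intro m
  induction m using Nat.strong_induction_on with
  | _ m ih =>
    intro hm
    rcases Nat.eq_zero_or_pos m with rfl | hpos
    · simp
    have newton (w : σ → K) := congrArg (aeval w) (mul_esymm_eq_sum σ K m)
    simp only [map_mul, map_natCast, map_pow, map_neg, map_one, map_sum] at newton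
    apply mul_left_cancel₀ (Nat.cast_ne_zero.mpr hpos.ne' : (m : K) ≠ 0)
    rw [newton u, newton v]
    congr 1
    refine sum_congr rfl fun a ha => ?_
    rw [mem_filter, HasAntidiagonal.mem_antidiagonal] at ha
    rw [ih a.1 ha.2 (by omega)]
    congr 1
    simpa [psum] using h a.2 (by omega)

/-- Two families over a field of characteristic zero with the same power sums up to the size of
the index type agree as multisets. -/
theorem Multiset.map_univ_eq_of_sum_pow_eq {σ K : Type*} [Fintype σ] [Field K] [CharZero K]
    {u v : σ → K} (h : ∀ j ≤ Fintype.card σ, ∑ i, u i ^ j = ∑ i, v i ^ j) :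
    Finset.univ.val.map u = Finset.univ.val.map v := by
  have he := MvPolynomial.aeval_esymm_eq_of_sum_pow_eq h
  simp only [MvPolynomial.aeval_esymm_eq_multiset_esymm] at he
  have hp : ((Finset.univ.val.map u).map fun t => Polynomial.X - Polynomial.C t).prod =
      ((Finset.univ.val.map v).map fun t => Polynomial.X - Polynomial.C t).prod := by
    rw [Multiset.prod_X_sub_X_eq_sum_esymm, Multiset.prod_X_sub_X_eq_sum_esymm]
    simp only [Multiset.card_map]
    refine Finset.sum_congr rfl fun j hj => ?_
    rw [he j (Nat.lt_succ_iff.mp (Finset.mem_range.mp hj))]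
  simpa only [Polynomial.roots_multiset_prod_X_sub_C] using congrArg Polynomial.roots hp

/-- Two families indexed by a finite type that agree as multisets differ by a permutation of the
index type. -/
theorem Multiset.exists_perm_of_map_univ_eq {σ α : Type*} [Fintype σ] {u v : σ → α}
    (h : Finset.univ.val.map u = Finset.univ.val.map v) :
    ∃ e : Equiv.Perm σ, ∀ i, v (e i) = u i := by
  classical
  have hcard (a : α) : Fintype.card {i // u i = a} = Fintype.card {i // v i = a} := by
    have := congrArg (Multiset.count a) h
    simp only [Multiset.count_map, eq_comm (a := a)] at this
    rw [Fintype.card_subtype, Fintype.card_subtype]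
    exact this
  exact ⟨Equiv.ofFiberEquiv fun a => Fintype.equivOfCardEq (hcard a),
    Equiv.ofFiberEquiv_map _⟩

/-- A continuous real function on a compact set that is constant on the fibres of a continuous map
`F` factors through `F` via a continuous function defined everywhere. -/
theorem IsCompact.exists_continuous_factor {X Y : Type*} [TopologicalSpace X] [TopologicalSpace Y]
    [T2Space Y] [NormalSpace Y] {s : Set X} (hs : IsCompact s) {F : X → Y} (hF : ContinuousOn F s)
    {g : X → ℝ} (hg : ContinuousOn g s)
    (h : ∀ x ∈ s, ∀ y ∈ s, F x = F y → g x = g y) :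
    ∃ ρ : Y → ℝ, Continuous ρ ∧ ∀ x ∈ s, g x = ρ (F x) := by
  have := isCompact_iff_compactSpace.mp hs
  have hF' : Continuous (s.domRestrict F) := hF.domRestrict
  let f : C(s, Set.range (s.domRestrict F)) := ⟨_, hF'.rangeFactorization⟩
  have hq : Topology.IsQuotientMap f :=
    f.continuous.isClosedMap.isQuotientMap f.continuous Set.rangeFactorization_surjective
  have hfac : Function.FactorsThrough (⟨s.domRestrict g, hg.domRestrict⟩ : C(s, ℝ)) f :=
    fun x y hxy => h x x.2 y y.2 (congrArg Subtype.val hxy)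
  obtain ⟨ρ, hρ⟩ := (hq.lift _ hfac).exists_restrict_eq (isCompact_range hF').isClosed
  refine ⟨ρ, ρ.continuous, fun x hx => ?_⟩
  have h1 := DFunLike.congr_fun (hq.lift_comp _ hfac) ⟨x, hx⟩
  rw [← hρ] at h1
  exact h1.symm

/-- If two points have the same coordinates off `p` and the same power sums of the coordinates
in `p`, then they differ by a permutation fixing every index off `p`. -/
theorem exists_perm_of_sum_pow_eq {ι K : Type*} [Fintype ι] [Field K] [CharZero K]
    (p : ι → Prop) [DecidablePred p] {x y : ι → K} (hxy : ∀ i, ¬ p i → x i = y i)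
    (h : ∀ j ≤ Fintype.card ι,
      ∑ i, (if p i then x i else 0) ^ j = ∑ i, (if p i then y i else 0) ^ j) :
    ∃ e : Equiv.Perm ι, (∀ i, ¬ p i → e i = i) ∧ ∀ i, y (e i) = x i := by
  have hsum (w : ι → K) (j : ℕ) : ∑ i, (if p i then w i else 0) ^ j =
      ∑ i : {i // p i}, w i ^ j + ∑ _i : {i // ¬ p i}, (0 : K) ^ j := by
    rw [← Fintype.sum_subtype_add_sum_subtype p]
    congr 1
    · exact Finset.sum_congr rfl fun i _ => by rw [if_pos i.2]
    · exact Finset.sum_congr rfl fun i _ => by rw [if_neg i.2]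
  obtain ⟨e, he⟩ := Multiset.exists_perm_of_map_univ_eq
    (Multiset.map_univ_eq_of_sum_pow_eq (u := fun i : {i // p i} => x i) (v := fun i => y i)
      fun j hj => by
        have := h j (hj.trans (Fintype.card_subtype_le p))
        rwa [hsum x, hsum y, add_left_inj] at this)
  refine ⟨Equiv.Perm.ofSubtype e, fun i hi => Equiv.Perm.ofSubtype_apply_of_not_mem e hi,
    fun i => ?_⟩
  by_cases hi : p i
  · rw [Equiv.Perm.ofSubtype_apply_of_mem e hi]
    exact he ⟨i, hi⟩
  · rw [Equiv.Perm.ofSubtype_apply_of_not_mem e hi, hxy i hi]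

/-- With `M` the projection onto the first `k` coordinates, a continuous
`ψ : [0,1]ⁿ → ℝ` is invariant under all permutations of its first `k` coordinates iff
`ψ x = ρ ((I − M) x, ∑_{i=1}^n γ((M x) i))` for some continuous `ρ`, where
`γ t = (1, t, …, tⁿ)`. -/
theorem statement7 (n k : ℕ) (hk1 : 1 ≤ k) (hkn : k ≤ n) (ψ : (Fin n → ℝ) → ℝ)
    (hψ : ContinuousOn ψ (Set.Icc (0 : Fin n → ℝ) 1)) :
    (∀ σ : Equiv.Perm (Fin n), (∀ i : Fin n, k ≤ (i : ℕ) → σ i = i) →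
        ∀ x ∈ Set.Icc (0 : Fin n → ℝ) 1, ψ (fun i => x (σ⁻¹ i)) = ψ x) ↔
      ∃ ρ : (Fin n → ℝ) × (Fin (n + 1) → ℝ) → ℝ, Continuous ρ ∧
        ∀ x ∈ Set.Icc (0 : Fin n → ℝ) 1,
          ψ x = ρ ((fun i : Fin n => if (i : ℕ) < k then 0 else x i),
            ∑ i : Fin n, fun j : Fin (n + 1) =>
              (if (i : ℕ) < k then x i else 0) ^ (j : ℕ)) := by
  constructor
  · intro hinv
    refine isCompact_Icc.exists_continuous_factor (F := fun x : Fin n → ℝ =>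
      ((fun i : Fin n => if (i : ℕ) < k then 0 else x i),
        ∑ i : Fin n, fun j : Fin (n + 1) => (if (i : ℕ) < k then x i else 0) ^ (j : ℕ))) ?_ hψ ?_
    · refine Continuous.continuousOn (Continuous.prodMk ?_ ?_)
      · refine continuous_pi fun i => ?_
        split_ifs <;> fun_prop
      · refine continuous_finsetSum _ fun i _ => continuous_pi fun j => Continuous.pow ?_ _
        split_ifs <;> fun_prop
    · intro x hx y hy hxy
      obtain ⟨h1, h2⟩ := Prod.ext_iff.mp hxy
      obtain ⟨e, hfix, he⟩ := exists_perm_of_sum_pow_eq (fun i : Fin n => (i : ℕ) < k)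
        (x := x) (y := y) (fun i hi => by simpa [hi] using congrFun h1 i) (fun j hj => by
          rw [Fintype.card_fin] at hj
          simpa only [Finset.sum_apply] using congrFun h2 ⟨j, Nat.lt_succ_of_le hj⟩)
      rw [← hinv e (fun i hi => hfix i hi.not_gt) x hx]
      congr 1
      funext i
      rw [← he]
      exact congrArg y (e.apply_symm_apply i)
  · rintro ⟨ρ, -, hρ⟩ σ hσ x hx
    have hfix (i : Fin n) (hi : k ≤ (i : ℕ)) : σ⁻¹ i = i :=
      Equiv.Perm.inv_eq_iff_eq.mpr (hσ i hi).symm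
    have hlt (i : Fin n) : ((σ⁻¹ i : Fin n) : ℕ) < k ↔ (i : ℕ) < k := by
      constructor <;> intro h <;> by_contra! hc
      · rw [hfix i hc] at h
        omega
      · have : i = σ⁻¹ i := (σ.apply_symm_apply i).symm.trans (hσ _ hc)
        rw [← this] at hc
        omega
    rw [hρ (fun i => x (σ⁻¹ i)) ⟨fun i => hx.1 (σ⁻¹ i), fun i => hx.2 (σ⁻¹ i)⟩, hρ x hx]
    congr 2
    · funext i
      split_ifs with hi
      · rfl
      · rw [hfix i (not_lt.mp hi)]
    · rw [← Equiv.sum_comp σ⁻¹ fun (i : Fin n) (j : Fin (n + 1)) =>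
        (if (i : ℕ) < k then x i else 0) ^ (j : ℕ)]
      simp only [hlt]
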